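/- arXiv:2205.04866 — 2 statements merged into one kernel-verified Lean document; each statement's English description precedes it below -/
import Mathlib

section
/- For all natural numbers r, s there is an isomorphism of ℝ-algebras Cl(s+2, r) ≅ Cl(r, s) ⊗_ℝ M₂(ℝ), where Cl(r,s) denotes the Clifford algebra of the quadratic form Q_{r,s} and M₂(ℝ) is the algebra of 2×2 real matrices. -/
open scoped TensorProduct

/-- The quadratic form of signature `(r, s)` (`r` pluses, `s` minuses) on `ℝ^(r+s)`. -/
noncomputable def Qform (r s : ℕ) : QuadraticForm ℝ (Fin (r + s) → ℝ) :=
  QuadraticMap.weightedSumSquares ℝ (fun i : Fin (r + s) => if (i : ℕ) < r then (1 : ℝ) else -1)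

/-- The algebra map out of `M₂(K)` sending the reflections `!![0, 1; 1, 0]` and `!![1, 0; 0, -1]`
to two anticommuting square roots of `1`. -/
def matrixTwoLift {K A : Type*} [Field K] [NeZero (2 : K)] [Ring A] [Algebra K A] (x z : A)
    (hx : x * x = 1) (hz : z * z = 1) (hzx : z * x = -(x * z)) :
    Matrix (Fin 2) (Fin 2) K →ₐ[K] A :=
  AlgHom.ofLinearMap
    { toFun := fun N => ((N 0 0 + N 1 1) / 2) • (1 : A) + ((N 0 0 - N 1 1) / 2) • z
        + ((N 0 1 + N 1 0) / 2) • x + ((N 1 0 - N 0 1) / 2) • (x * z)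
      map_add' := fun M N => by
        simp only [Matrix.add_apply]
        module
      map_smul' := fun c N => by
        simp only [Matrix.smul_apply, RingHom.id_apply, smul_eq_mul]
        module }
    (by
      have h2 : (2 : K) ≠ 0 := NeZero.ne _
      simp [← two_mul, h2])
    (fun M N => by
      have h2 : (2 : K) ≠ 0 := NeZero.ne _
      have hx' (a : A) : x * (x * a) = a := by rw [← mul_assoc, hx, one_mul]
      have hzx' (a : A) : z * (x * a) = -(x * (z * a)) := by
        rw [← mul_assoc, hzx, neg_mul, mul_assoc]
      simp only [LinearMap.coe_mk, AddHom.coe_mk, Matrix.mul_apply, Fin.sum_univ_two, mul_add,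
        add_mul, smul_mul_smul_comm, one_mul, mul_one, mul_assoc, hx, hz, hzx, hx', hzx', mul_neg]
      match_scalars <;> field_simp <;> ring)

theorem matrixTwoLift_apply {K A : Type*} [Field K] [NeZero (2 : K)] [Ring A] [Algebra K A]
    (x z : A) (hx : x * x = 1) (hz : z * z = 1) (hzx : z * x = -(x * z))
    (N : Matrix (Fin 2) (Fin 2) K) :
    matrixTwoLift x z hx hz hzx N = ((N 0 0 + N 1 1) / 2) • (1 : A) + ((N 0 0 - N 1 1) / 2) • z
        + ((N 0 1 + N 1 0) / 2) • x + ((N 1 0 - N 0 1) / 2) • (x * z) :=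
  rfl

/-- If `Q'` is the orthogonal sum of `-Q` and two copies of the form `x²`, then
`Cl(Q') ≅ Cl(Q) ⊗ M₂(K)`. -/
theorem nonempty_cliffordAlgebra_algEquiv_tensor_matrix {K V W : Type*} [Field K]
    [NeZero (2 : K)] [AddCommGroup V] [Module K V] [AddCommGroup W] [Module K W]
    (Q : QuadraticForm K V) (Q' : QuadraticForm K W) (e : W ≃ₗ[K] V × K × K)
    (he : ∀ w, Q' w = -Q (e w).1 + (e w).2.1 ^ 2 + (e w).2.2 ^ 2) :
    Nonempty (CliffordAlgebra Q' ≃ₐ[K] CliffordAlgebra Q ⊗[K] Matrix (Fin 2) (Fin 2) K) := by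
  have h2 : (2 : K) ≠ 0 := NeZero.ne _
  have he' (m : V) (u v : K) : Q' (e.symm (m, u, v)) = -Q m + u ^ 2 + v ^ 2 := by
    simp [he]
  set X : Matrix (Fin 2) (Fin 2) K := !![0, 1; 1, 0] with hX
  set Z : Matrix (Fin 2) (Fin 2) K := !![1, 0; 0, -1] with hZ
  set J : Matrix (Fin 2) (Fin 2) K := !![0, -1; 1, 0] with hJ
  have hXX : X * X = 1 := by simp [hX, Matrix.one_fin_two]
  have hZZ : Z * Z = 1 := by simp [hZ, Matrix.one_fin_two]
  have hXZ : X * Z = J := by simp [hX, hZ, hJ]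
  have hZX : Z * X = -J := by simp [hX, hZ, hJ]
  have hJJ : J * J = -1 := by simp [hJ, Matrix.one_fin_two]
  have hJX : J * X = -Z := by simp [hX, hZ, hJ]
  have hXJ : X * J = Z := by simp [hX, hZ, hJ]
  have hJZ : J * Z = X := by simp [hX, hZ, hJ]
  have hZJ : Z * J = -X := by simp [hX, hZ, hJ]
  set ι := CliffordAlgebra.ι Q
  set ι' := CliffordAlgebra.ι Q'
  set x := ι' (e.symm (0, 1, 0)) with hx
  set z := ι' (e.symm (0, 0, 1)) with hz
  let k : V →ₗ[K] CliffordAlgebra Q' := ι' ∘ₗ e.symm.toLinearMap ∘ₗ LinearMap.inl K V (K × K)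
  have hk (m : V) : k m = ι' (e.symm (m, 0, 0)) := rfl
  have hxx : x * x = 1 := by simp [hx, ι', CliffordAlgebra.ι_sq_scalar, he']
  have hzz : z * z = 1 := by simp [hz, ι', CliffordAlgebra.ι_sq_scalar, he']
  have hkk (m : V) : k m * k m = -algebraMap K _ (Q m) := by
    simp [hk, ι', CliffordAlgebra.ι_sq_scalar, he']
  have anti {a b : V × K × K} (h : Q' (e.symm (a + b)) = Q' (e.symm a) + Q' (e.symm b)) :
      ι' (e.symm a) * ι' (e.symm b) = -(ι' (e.symm b) * ι' (e.symm a)) := by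
    apply CliffordAlgebra.ι_mul_ι_comm_of_isOrtho
    rw [QuadraticMap.isOrtho_def, ← map_add, h]
  have hzx : z * x = -(x * z) := anti (by simp [he'])
  have hxk (m : V) : x * k m = -(k m * x) := anti (by simp [he', add_comm])
  have hzk (m : V) : z * k m = -(k m * z) := anti (by simp [he', add_comm])
  have hxx' (a) : x * (x * a) = a := by rw [← mul_assoc, hxx, one_mul]
  have hzx' (a) : z * (x * a) = -(x * (z * a)) := by rw [← mul_assoc, hzx, neg_mul, mul_assoc]
  have hxk' (m a) : x * (k m * a) = -(k m * (x * a)) := by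
    rw [← mul_assoc, hxk, neg_mul, mul_assoc]
  have hzk' (m a) : z * (k m * a) = -(k m * (z * a)) := by
    rw [← mul_assoc, hzk, neg_mul, mul_assoc]
  let f₀ : W →ₗ[K] CliffordAlgebra Q ⊗[K] Matrix (Fin 2) (Fin 2) K :=
    ((((TensorProduct.mk K _ _).flip J ∘ₗ ι).coprod
      ((LinearMap.toSpanSingleton K _ (1 ⊗ₜ X)).coprod
        (LinearMap.toSpanSingleton K _ (1 ⊗ₜ Z)))) ∘ₗ e.toLinearMap)
  have hf₀ (w) : f₀ w = ι (e w).1 ⊗ₜ J + ((e w).2.1 • 1 ⊗ₜ X + (e w).2.2 • 1 ⊗ₜ Z) := rfl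
  let f := CliffordAlgebra.lift Q' ⟨f₀, fun w => by
    simp only [hf₀, add_mul, mul_add, smul_mul_assoc, mul_smul_comm,
      Algebra.TensorProduct.tmul_mul_tmul, one_mul, mul_one, hXX, hZZ, hXZ, hZX, hJJ, hJX, hXJ,
      hJZ, hZJ, TensorProduct.tmul_neg, he, ι, CliffordAlgebra.ι_sq_scalar,
      Algebra.algebraMap_eq_smul_one, TensorProduct.smul_tmul', Algebra.TensorProduct.one_def]
    simp only [← TensorProduct.smul_tmul']
    module⟩
  have hf (m u v) : f (ι' (e.symm (m, u, v))) = ι m ⊗ₜ J + (u • 1 ⊗ₜ X + v • 1 ⊗ₜ Z) := by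
    exact (CliffordAlgebra.lift_ι_apply _ _ _).trans (by simp [hf₀])
  have hfx : f x = 1 ⊗ₜ X := by simp [hx, hf]
  have hfz : f z = 1 ⊗ₜ Z := by simp [hz, hf]
  let g₁ := CliffordAlgebra.lift Q (A := CliffordAlgebra Q')
    ⟨LinearMap.mulRight K (z * x) ∘ₗ k, fun m => by
    simp [mul_assoc, hzx, hzk', hxk', hkk, hzx', hxx, hzz]⟩
  have hg₁ (m) : g₁ (ι m) = k m * (z * x) :=
    CliffordAlgebra.lift_ι_apply _ _ _
  let g₂ := matrixTwoLift (K := K) x z hxx hzz hzx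
  have hg₂X : g₂ X = x := by simp [g₂, matrixTwoLift_apply, hX, ← two_mul, h2]
  have hg₂Z : g₂ Z = z := by simp [g₂, matrixTwoLift_apply, hZ, ← two_mul, h2]
  have hg₂J : g₂ J = x * z := by rw [← hXZ, map_mul, hg₂X, hg₂Z]
  have hcomm (a b) : Commute (g₁ a) (g₂ b) := by
    induction a using CliffordAlgebra.induction with
    | algebraMap r => rw [AlgHom.commutes]; exact Algebra.commutes r _
    | add a b ha hb => simpa using ha.add_left hb
    | mul a b ha hb => simpa using ha.mul_left hb
    | ι m =>
      have hx₁ : Commute (g₁ (ι m)) x := by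
        simp [Commute, SemiconjBy, hg₁, mul_assoc, hzx, hxk', hxx']
      have hz₁ : Commute (g₁ (ι m)) z := by
        simp [Commute, SemiconjBy, hg₁, mul_assoc, hzx, hzk', hzz, hzx']
      rw [matrixTwoLift_apply]
      exact ((((Commute.one_right _).smul_right _).add_right (hz₁.smul_right _)).add_right
        (hx₁.smul_right _)).add_right ((hx₁.mul_right hz₁).smul_right _)
  let g := Algebra.TensorProduct.lift g₁ g₂ hcomm
  refine ⟨AlgEquiv.ofAlgHom f g ?_ ?_⟩
  · refine Algebra.TensorProduct.ext ?_ ?_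
    · ext m
      suffices f (g₁ (ι m)) = ι m ⊗ₜ 1 by simpa [g]
      have hfk : f (k m) = ι m ⊗ₜ J := by simp [hk, hf]
      simp only [hg₁, map_mul, hfk, hfx, hfz, Algebra.TensorProduct.tmul_mul_tmul, hZX, mul_neg,
        hJJ, neg_neg, mul_one]
    · ext1 N
      suffices f (g₂ N) = 1 ⊗ₜ N by simpa [g]
      simp only [g₂, matrixTwoLift_apply, map_add, map_smul, map_mul, hfx, hfz, map_one,
        Algebra.TensorProduct.tmul_mul_tmul, mul_one, hXZ, Algebra.TensorProduct.one_def,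
        ← TensorProduct.tmul_smul, ← TensorProduct.tmul_add]
      congr 1
      ext i j
      fin_cases i <;> fin_cases j <;> simp [hX, hZ, hJ] <;> field_simp <;> ring
  · ext w
    obtain ⟨⟨m, u, v⟩, rfl⟩ := e.symm.surjective w
    suffices g (f (ι' (e.symm (m, u, v)))) = ι' (e.symm (m, u, v)) by simpa
    have : ι' (e.symm (m, u, v)) = k m + (u • x + v • z) := by
      simp only [hk, hx, hz, ← map_smul, ← map_add]
      simp
    rw [hf, this]
    simp [g, hg₁, hg₂X, hg₂Z, hg₂J, mul_assoc, hxx', hzz]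

/-- Split `ℝ^(s+2+r)` as `ℝ^(r+s) × ℝ × ℝ`, exchanging the first `s` and the last `r` coordinates. -/
def flipSplitEquiv (r s : ℕ) :
    (Fin (s + 2 + r) → ℝ) ≃ₗ[ℝ] (Fin (r + s) → ℝ) × ℝ × ℝ where
  toFun w := (Fin.append (fun i => w (Fin.natAdd (s + 2) i))
      (fun j => w (Fin.castAdd r (Fin.castAdd 2 j))),
    w (Fin.castAdd r (Fin.natAdd s 0)), w (Fin.castAdd r (Fin.natAdd s 1)))
  invFun p := Fin.append (Fin.append (fun j => p.1 (Fin.natAdd r j)) ![p.2.1, p.2.2])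
    (fun i => p.1 (Fin.castAdd s i))
  map_add' v w := by
    refine Prod.ext (funext fun i => ?_) rfl
    refine Fin.addCases (fun i => ?_) (fun i => ?_) i <;> simp
  map_smul' c w := by
    refine Prod.ext (funext fun i => ?_) rfl
    refine Fin.addCases (fun i => ?_) (fun i => ?_) i <;> simp
  left_inv w := by
    funext i
    refine Fin.addCases (fun i => Fin.addCases (fun i => ?_) ?_ i) (fun i => ?_) i
    · simp
    · simp
    · simp
  right_inv p := by
    refine Prod.ext (funext fun i => ?_) (by simp)
    refine Fin.addCases (fun i => ?_) (fun i => ?_) i <;> simp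

/-- `Cl(s+2, r) ≅ Cl(r, s) ⊗ M₂(ℝ)` as `ℝ`-algebras. -/
theorem cl_flip_iso_tensor_matrix (r s : ℕ) :
    Nonempty (CliffordAlgebra (Qform (s + 2) r) ≃ₐ[ℝ]
      (CliffordAlgebra (Qform r s) ⊗[ℝ] Matrix (Fin 2) (Fin 2) ℝ)) := by
  refine nonempty_cliffordAlgebra_algEquiv_tensor_matrix _ _ (flipSplitEquiv r s) fun w => ?_
  simp [Qform, flipSplitEquiv, QuadraticMap.weightedSumSquares_apply, Fin.sum_univ_add]
  ring
end

section
/- Let K be a mixed structure on (V, g), let P := K ∘ K̄, and let V⁺ := ker(P − id) ∩ V and V⁻ := ker(P + id) ∩ V. Then: (a) K maps the complexification of V⁺ into itself and the complexification of V⁻ into itself; (b) for every X in the complexification of V⁺ one has K(σX) = σ(KX), so K restricts to a real-linear operator I : V⁺ → V⁺, and I² = id on V⁺ (K acts on V⁺ as a paracomplex structure); (c) for every X in the complexification of V⁻ one has K(σX) = −σ(KX), so J := −i·K restricts to a real-linear operator J : V⁻ → V⁻, and J² = −id on V⁻ (K acts on V⁻ as i times a complex structure). -/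
open scoped TensorProduct

/-- The standard conjugation `σ` on the complexification `ℂ ⊗[ℝ] V`: the `ℂ`-antilinear
(`ℝ`-linear) involution whose fixed points are the real vectors. -/
noncomputable def conjC (V : Type*) [AddCommGroup V] [Module ℝ V] :
    (ℂ ⊗[ℝ] V) →ₗ[ℝ] (ℂ ⊗[ℝ] V) :=
  TensorProduct.map Complex.conjAe.toLinearMap LinearMap.id

/-- The canonical inclusion of `V` into its complexification `ℂ ⊗[ℝ] V`, `v ↦ 1 ⊗ v`. -/
noncomputable def inclC (V : Type*) [AddCommGroup V] [Module ℝ V] :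
    V →ₗ[ℝ] (ℂ ⊗[ℝ] V) :=
  TensorProduct.mk ℝ ℂ V 1

/-- The conjugate `K̄ = σ ∘ K ∘ σ` of a `ℂ`-linear map on the complexification. -/
noncomputable def conjMap {V : Type*} [AddCommGroup V] [Module ℝ V]
    (K : (ℂ ⊗[ℝ] V) →ₗ[ℂ] (ℂ ⊗[ℝ] V)) : (ℂ ⊗[ℝ] V) → (ℂ ⊗[ℝ] V) :=
  fun x => conjC V (K (conjC V x))

/-- A mixed structure on `(V, g)`: a `ℂ`-linear map `K` on `V_ℂ = ℂ ⊗[ℝ] V` with `K² = id`,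
`K K̄ = K̄ K`, and `g(KX, KY) = g(K̄X, K̄Y) = −g(X, Y)` for the `ℂ`-bilinear extension of
`g`. -/
def IsMixedStructure (V : Type*) [AddCommGroup V] [Module ℝ V]
    (g : LinearMap.BilinForm ℝ V) (K : (ℂ ⊗[ℝ] V) →ₗ[ℂ] (ℂ ⊗[ℝ] V)) : Prop :=
  (∀ x, K (K x) = x) ∧
  (∀ x, K (conjMap K x) = conjMap K (K x)) ∧
  (∀ x y, (LinearMap.BilinForm.baseChange ℂ g) (K x) (K y)
    = -(LinearMap.BilinForm.baseChange ℂ g) x y) ∧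
  (∀ x y, (LinearMap.BilinForm.baseChange ℂ g) (conjMap K x) (conjMap K y)
    = -(LinearMap.BilinForm.baseChange ℂ g) x y)

/-- The product structure `P = K ∘ σ ∘ K ∘ σ = K K̄` as a bundled `ℝ`-linear map. -/
noncomputable def prodStrL {V : Type*} [AddCommGroup V] [Module ℝ V]
    (K : (ℂ ⊗[ℝ] V) →ₗ[ℂ] (ℂ ⊗[ℝ] V)) : (ℂ ⊗[ℝ] V) →ₗ[ℝ] (ℂ ⊗[ℝ] V) :=
  (K.restrictScalars ℝ) ∘ₗ conjC V ∘ₗ (K.restrictScalars ℝ) ∘ₗ conjC V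

/-- The real eigenspace `V⁺ = ker(P − id) ∩ V`, viewed as a subspace of `V`. -/
noncomputable def Vplus {V : Type*} [AddCommGroup V] [Module ℝ V]
    (K : (ℂ ⊗[ℝ] V) →ₗ[ℂ] (ℂ ⊗[ℝ] V)) : Submodule ℝ V :=
  Submodule.comap (inclC V) (LinearMap.ker (prodStrL K - LinearMap.id))

/-- The real eigenspace `V⁻ = ker(P + id) ∩ V`, viewed as a subspace of `V`. -/
noncomputable def Vminus {V : Type*} [AddCommGroup V] [Module ℝ V]
    (K : (ℂ ⊗[ℝ] V) →ₗ[ℂ] (ℂ ⊗[ℝ] V)) : Submodule ℝ V :=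
  Submodule.comap (inclC V) (LinearMap.ker (prodStrL K + LinearMap.id))

/-- The complexification of `V⁺` inside `V_ℂ`. -/
noncomputable def Wplus {V : Type*} [AddCommGroup V] [Module ℝ V]
    (K : (ℂ ⊗[ℝ] V) →ₗ[ℂ] (ℂ ⊗[ℝ] V)) : Submodule ℂ (ℂ ⊗[ℝ] V) :=
  Submodule.span ℂ (inclC V '' (Vplus K : Set V))

/-- The complexification of `V⁻` inside `V_ℂ`. -/
noncomputable def Wminus {V : Type*} [AddCommGroup V] [Module ℝ V]
    (K : (ℂ ⊗[ℝ] V) →ₗ[ℂ] (ℂ ⊗[ℝ] V)) : Submodule ℂ (ℂ ⊗[ℝ] V) :=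
  Submodule.span ℂ (inclC V '' (Vminus K : Set V))

section Complexification

variable {V : Type*} [AddCommGroup V] [Module ℝ V]

lemma conjC_smul (c : ℂ) (x : ℂ ⊗[ℝ] V) :
    conjC V (c • x) = (starRingEnd ℂ) c • conjC V x := by
  induction x with
  | zero => simp
  | tmul a v => simp [conjC, TensorProduct.smul_tmul']
  | add x y hx hy => rw [smul_add, map_add, hx, hy, map_add, smul_add]

lemma conjC_inclC (v : V) : conjC V (inclC V v) = inclC V v := by
  simp [conjC, inclC]

lemma exists_eq_inclC_add_I_smul (x : ℂ ⊗[ℝ] V) :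
    ∃ a b : V, x = inclC V a + Complex.I • inclC V b := by
  induction x with
  | zero => exact ⟨0, 0, by simp⟩
  | tmul c v =>
    refine ⟨c.re • v, c.im • v, ?_⟩
    simp only [inclC, TensorProduct.mk_apply, ← TensorProduct.smul_tmul,
      TensorProduct.smul_tmul', ← TensorProduct.add_tmul]
    congr 1
    apply Complex.ext <;> simp
  | add x y hx hy =>
    obtain ⟨a, b, rfl⟩ := hx
    obtain ⟨c, d, rfl⟩ := hy
    exact ⟨a + c, b + d, by simp only [map_add, smul_add]; abel⟩

/-- The fixed points of the conjugation are the real vectors. -/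
lemma exists_eq_inclC_of_conjC_eq {x : ℂ ⊗[ℝ] V} (hx : conjC V x = x) :
    ∃ v : V, x = inclC V v := by
  obtain ⟨a, b, rfl⟩ := exists_eq_inclC_add_I_smul x
  rw [map_add, conjC_smul, conjC_inclC, conjC_inclC, Complex.conj_I, neg_smul] at hx
  have hb : Complex.I • inclC V b = 0 := by
    have : IsAddTorsionFree (ℂ ⊗[ℝ] V) := .of_module_rat _
    exact self_eq_neg.mp (add_left_cancel hx).symm
  exact ⟨a, by rw [hb, add_zero]⟩

variable {K : (ℂ ⊗[ℝ] V) →ₗ[ℂ] (ℂ ⊗[ℝ] V)}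

lemma mem_Vplus {v : V} : v ∈ Vplus K ↔ K (conjC V (K (inclC V v))) = inclC V v := by
  simp [Vplus, prodStrL, conjC_inclC, sub_eq_zero]

lemma mem_Vminus {v : V} : v ∈ Vminus K ↔ K (conjC V (K (inclC V v))) = -inclC V v := by
  simp [Vminus, prodStrL, conjC_inclC, add_eq_zero_iff_eq_neg]

lemma conjC_map_of_mem_Vplus (hK : ∀ x, K (K x) = x) {v : V} (hv : v ∈ Vplus K) :
    conjC V (K (inclC V v)) = K (inclC V v) := by
  rw [← hK (conjC V _), mem_Vplus.mp hv]

lemma conjC_map_of_mem_Vminus (hK : ∀ x, K (K x) = x) {v : V} (hv : v ∈ Vminus K) :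
    conjC V (K (inclC V v)) = -K (inclC V v) := by
  rw [← hK (conjC V _), mem_Vminus.mp hv, map_neg]

lemma exists_mem_Vplus_map_eq (hK : ∀ x, K (K x) = x) {v : V} (hv : v ∈ Vplus K) :
    ∃ w ∈ Vplus K, K (inclC V v) = inclC V w := by
  obtain ⟨w, hw⟩ := exists_eq_inclC_of_conjC_eq (conjC_map_of_mem_Vplus hK hv)
  exact ⟨w, by rw [mem_Vplus, ← hw, hK, conjC_inclC], hw⟩

lemma exists_mem_Vminus_map_eq (hK : ∀ x, K (K x) = x) {v : V} (hv : v ∈ Vminus K) :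
    ∃ w ∈ Vminus K, (-Complex.I) • K (inclC V v) = inclC V w := by
  obtain ⟨w, hw⟩ := exists_eq_inclC_of_conjC_eq (x := (-Complex.I) • K (inclC V v)) (by
    simp [conjC_smul, conjC_map_of_mem_Vminus hK hv])
  refine ⟨w, ?_, hw⟩
  rw [mem_Vminus, ← hw, map_smul, hK, conjC_smul, conjC_inclC, map_smul]
  simp

lemma map_mem_Wplus (hK : ∀ x, K (K x) = x) {x : ℂ ⊗[ℝ] V} (hx : x ∈ Wplus K) :
    K x ∈ Wplus K := by
  suffices h : Wplus K ≤ (Wplus K).comap K from h hx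
  refine Submodule.span_le.mpr ?_
  rintro _ ⟨v, hv, rfl⟩
  obtain ⟨w, hw, h⟩ := exists_mem_Vplus_map_eq hK hv
  exact Submodule.mem_comap.mpr (h ▸ Submodule.subset_span ⟨w, hw, rfl⟩)

lemma map_mem_Wminus (hK : ∀ x, K (K x) = x) {x : ℂ ⊗[ℝ] V} (hx : x ∈ Wminus K) :
    K x ∈ Wminus K := by
  suffices h : Wminus K ≤ (Wminus K).comap K from h hx
  refine Submodule.span_le.mpr ?_
  rintro _ ⟨v, hv, rfl⟩
  obtain ⟨w, hw, h⟩ := exists_mem_Vminus_map_eq hK hv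
  have hKv : K (inclC V v) = Complex.I • inclC V w := by
    rw [← h, smul_smul]
    simp
  exact Submodule.mem_comap.mpr
    (hKv ▸ Submodule.smul_mem _ _ (Submodule.subset_span ⟨w, hw, rfl⟩))

lemma map_conjC_of_mem_Wplus (hK : ∀ x, K (K x) = x) {x : ℂ ⊗[ℝ] V} (hx : x ∈ Wplus K) :
    K (conjC V x) = conjC V (K x) := by
  induction hx using Submodule.span_induction with
  | mem x hx =>
    obtain ⟨v, hv, rfl⟩ := hx
    rw [conjC_inclC, conjC_map_of_mem_Vplus hK hv]
  | zero => simp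
  | add x y _ _ hx hy => simp only [map_add, hx, hy]
  | smul c x _ hx => simp only [conjC_smul, map_smul, hx]

lemma map_conjC_of_mem_Wminus (hK : ∀ x, K (K x) = x) {x : ℂ ⊗[ℝ] V} (hx : x ∈ Wminus K) :
    K (conjC V x) = -conjC V (K x) := by
  induction hx using Submodule.span_induction with
  | mem x hx =>
    obtain ⟨v, hv, rfl⟩ := hx
    rw [conjC_inclC, conjC_map_of_mem_Vminus hK hv, neg_neg]
  | zero => simp
  | add x y _ _ hx hy => simp only [map_add, hx, hy, neg_add]
  | smul c x _ hx => simp only [conjC_smul, map_smul, hx, smul_neg]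

end Complexification

/-- For a mixed structure `K`: (a) `K` preserves the complexifications of `V⁺` and `V⁻`;
(b) on the complexification of `V⁺`, `K` commutes with conjugation, hence restricts to a
real-linear operator `I` on `V⁺` with `I² = id` (a paracomplex structure); (c) on the
complexification of `V⁻`, `K` anticommutes with conjugation, hence `J := −i·K` restricts
to a real-linear operator on `V⁻` with `J² = −id` (`K` is `i` times a complex
structure there). -/
theorem mixedStructure_para_and_complex (V : Type*) [AddCommGroup V] [Module ℝ V]
    [FiniteDimensional ℝ V] (g : LinearMap.BilinForm ℝ V)
    (hsymm : ∀ x y, g x y = g y x) (hnd : ∀ x, (∀ y, g x y = 0) → x = 0)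
    (K : (ℂ ⊗[ℝ] V) →ₗ[ℂ] (ℂ ⊗[ℝ] V)) (hK : IsMixedStructure V g K) :
    -- (a)
    (∀ x ∈ Wplus K, K x ∈ Wplus K) ∧
    (∀ x ∈ Wminus K, K x ∈ Wminus K) ∧
    -- (b)
    (∀ x ∈ Wplus K, K (conjC V x) = conjC V (K x)) ∧
    (∀ v ∈ Vplus K, ∃ w ∈ Vplus K, K (inclC V v) = inclC V w) ∧
    (∀ x ∈ Wplus K, K (K x) = x) ∧
    -- (c)
    (∀ x ∈ Wminus K, K (conjC V x) = -conjC V (K x)) ∧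
    (∀ v ∈ Vminus K, ∃ w ∈ Vminus K, (-Complex.I) • K (inclC V v) = inclC V w) ∧
    (∀ x ∈ Wminus K, (-Complex.I) • K ((-Complex.I) • K x) = -x) := by
  have hKK := hK.1
  refine ⟨fun x => map_mem_Wplus hKK, fun x => map_mem_Wminus hKK,
    fun x => map_conjC_of_mem_Wplus hKK, fun v => exists_mem_Vplus_map_eq hKK,
    fun x _ => hKK x, fun x => map_conjC_of_mem_Wminus hKK,
    fun v => exists_mem_Vminus_map_eq hKK, fun x _ => ?_⟩
  rw [map_smul, hKK, smul_smul]
  simp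
end
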